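/- arXiv:1209.5266 — 2 statements merged into one kernel-verified Lean document; each statement's English description precedes it below -/
import Mathlib

section
/- Over a finite field F_Q, for n ≥ 1, the number of pairs (F1, F2) of binary forms of degrees (n, n) such that F1 ≠ 0 and F1, F1', F2 have no common root on P^1 over the algebraic closure equals the number of binary forms f of degree n over F_Q[ε]/(ε^2) whose reductions define a subscheme of P^1_{F_Q[ε]/(ε^2)} smooth over the base at every point; in particular this count is Q^{2n+2}(1 - Q^{-2} - Q^{-3} + Q^{-5}) for n ≥ 3. -/
open MvPolynomial

/-- The homogeneous binary form of degree `n` with coefficient vector `c`. -/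
noncomputable def form (F : Type*) [Field F] (n : ℕ) (c : Fin (n + 1) → F) :
    MvPolynomial (Fin 2) F :=
  ∑ i : Fin (n + 1), C (c i) * X 0 ^ (i : ℕ) * X 1 ^ (n - (i : ℕ))

/-- The linear form cutting out the point `[a : b]` of `P^1`. -/
noncomputable def lin {K : Type*} [Field K] (a b : K) : MvPolynomial (Fin 2) K :=
  C b * X 0 - C a * X 1

/-- A pair of binary forms (of degrees `n₁`, `n₂`) is good: the first form is nonzero
and `F1`, `F1'`, `F2` have no common root on `P^1` over the algebraic closure, i.e. no
geometric point is a multiple root of `F1` and a root of `F2`. -/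
def GoodPair {F : Type*} [Field F] {n₁ n₂ : ℕ} (c₁ : Fin (n₁ + 1) → F)
    (c₂ : Fin (n₂ + 1) → F) : Prop :=
  form F n₁ c₁ ≠ 0 ∧ ∀ a b : AlgebraicClosure F, (a ≠ 0 ∨ b ≠ 0) →
    ¬ (lin a b ^ 2 ∣ (form F n₁ c₁).map (algebraMap F (AlgebraicClosure F)) ∧
       lin a b ∣ (form F n₂ c₂).map (algebraMap F (AlgebraicClosure F)))

open Polynomial in
theorem form_degreeLTEquiv {F : Type*} [Field F] (n : ℕ) (p : degreeLT F (n + 1)) :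
    form F n (degreeLTEquiv F (n + 1) p) = homogenize (p : F[X]) n := by
  have hp : (p : F[X]) = ∑ i : Fin (n + 1), monomial (i : ℕ) ((p : F[X]).coeff i) := by
    conv_lhs => rw [← (degreeLTEquiv F (n + 1)).symm_apply_apply p]
    rfl
  rw [hp, homogenize_finsetSum, form]
  refine Finset.sum_congr rfl fun i _ => ?_
  rw [homogenize_monomial (Nat.lt_succ_iff.mp i.2), MvPolynomial.monomial_eq]
  simp [degreeLTEquiv, Finsupp.update_eq_add_single, mul_assoc, Finsupp.prod_fintype]

open Polynomial in
theorem lin_pow_dvd_homogenize_iff {K : Type*} [Field K] {n : ℕ} {p : K[X]}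
    (hp : p.natDegree ≤ n) {a b : K} (hb : b ≠ 0) (k : ℕ) :
    lin a b ^ k ∣ homogenize p n ↔ (Polynomial.X - Polynomial.C (a / b)) ^ k ∣ p := by
  have hlin : lin a b = MvPolynomial.C b *
      (MvPolynomial.X 0 - MvPolynomial.C (a / b) * MvPolynomial.X 1) := by
    rw [lin, mul_sub, ← mul_assoc, ← MvPolynomial.C_mul, mul_div_cancel₀ _ hb]
  have hunit : IsUnit (MvPolynomial.C b ^ k : MvPolynomial (Fin 2) K) :=
    ((isUnit_iff_ne_zero.2 hb).map MvPolynomial.C).pow k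
  rw [hlin, mul_pow, hunit.mul_left_dvd]
  constructor
  · intro h
    have := map_dvd (MvPolynomial.aeval ![(Polynomial.X : K[X]), 1]) h
    rw [aeval_homogenize_X_one p hp] at this
    simpa using this
  · rintro ⟨h, rfl⟩
    rcases eq_or_ne h 0 with rfl | hh
    · simp
    have hm : ((Polynomial.X - Polynomial.C (a / b)) ^ k : K[X]).Monic := (monic_X_sub_C _).pow k
    have hd : ((Polynomial.X - Polynomial.C (a / b)) ^ k : K[X]).natDegree = k := by
      simp [(monic_X_sub_C (a / b)).natDegree_pow]
    rw [hm.natDegree_mul' hh, hd] at hp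
    obtain ⟨m, rfl⟩ := Nat.exists_eq_add_of_le (le_of_add_le_left hp)
    rw [homogenize_mul _ _ hd.le (by lia)]
    refine Dvd.intro _ (congrArg (· * _) ?_)
    symm
    apply homogenize_eq_of_isHomogeneous
    · have : (MvPolynomial.X 0 - MvPolynomial.C (a / b) * MvPolynomial.X 1 :
          MvPolynomial (Fin 2) K).IsHomogeneous 1 := by
        refine (MvPolynomial.isHomogeneous_X K 0).sub ?_
        simpa using (MvPolynomial.isHomogeneous_C (Fin 2) (a / b)).mul
          (MvPolynomial.isHomogeneous_X K (1 : Fin 2))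
      simpa using this.pow k
    · simp

open Polynomial in
theorem lin_zero_right_pow_dvd_homogenize_iff {K : Type*} [Field K] {n k : ℕ} {p : K[X]}
    (hp : p.natDegree ≤ n) (hk : k ≤ n) {a : K} (ha : a ≠ 0) :
    lin a 0 ^ k ∣ homogenize p n ↔ p.natDegree ≤ n - k := by
  have hlin : lin a 0 = MvPolynomial.C (-a) * MvPolynomial.X 1 := by
    simp [lin]
  have hunit : IsUnit (MvPolynomial.C (-a) ^ k : MvPolynomial (Fin 2) K) :=
    ((isUnit_iff_ne_zero.2 (neg_ne_zero.2 ha)).map MvPolynomial.C).pow k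
  rw [hlin, mul_pow, hunit.mul_left_dvd]
  constructor
  · rintro ⟨r, hr⟩
    rw [natDegree_le_iff_coeff_eq_zero]
    intro i hi
    rcases lt_or_ge n i with hni | hin
    · exact coeff_eq_zero_of_natDegree_lt (hp.trans_lt hni)
    have h0 := coeff_homogenize p n (Finsupp.single 0 i + Finsupp.single 1 (n - i))
    rw [hr, MvPolynomial.X_pow_eq_monomial, MvPolynomial.coeff_monomial_mul', if_neg] at h0
    · simpa [hin] using h0.symm
    · intro hle
      have := hle 1
      simp at this
      lia
  · intro h
    have := homogenize_mul p 1 h (n := k) (by simp)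
    rw [mul_one, Nat.sub_add_cancel hk, homogenize_one] at this
    exact this ▸ dvd_mul_left _ _

open Polynomial in
/-- No nonunit `D` satisfies `D ^ 2 ∣ f` and `D ∣ g`. -/
def IsReducedPair {F : Type*} [Field F] (f g : F[X]) : Prop :=
  ∀ D : F[X], D ^ 2 ∣ f → D ∣ g → IsUnit D

open Polynomial in
theorem isReducedPair_iff_forall_root {F K : Type*} [Field F] [PerfectField F] [Field K]
    [Algebra F K] [IsAlgClosed K] [Algebra.IsAlgebraic F K] {f g : F[X]} (hf : f ≠ 0) :
    IsReducedPair f g ↔ ∀ α : K,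
      ¬ ((Polynomial.X - Polynomial.C α) ^ 2 ∣ f.map (algebraMap F K) ∧
        (Polynomial.X - Polynomial.C α) ∣ g.map (algebraMap F K)) := by
  constructor
  · rintro h α ⟨h1, h2⟩
    have hint : IsIntegral F α := Algebra.IsIntegral.isIntegral α
    have hroot : ∀ q : F[X], (Polynomial.X - Polynomial.C α) ∣ q.map (algebraMap F K) →
        minpoly F α ∣ q := fun q hq => by
      apply minpoly.dvd
      rwa [dvd_iff_isRoot, IsRoot, eval_map_algebraMap] at hq
    obtain ⟨q, rfl⟩ := hroot f ((dvd_pow_self _ two_ne_zero).trans h1)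
    have hsep : ((minpoly F α).map (algebraMap F K)).Separable :=
      (PerfectField.separable_of_irreducible (minpoly.irreducible hint)).map
    have hq : (Polynomial.X - Polynomial.C α) ∣ q.map (algebraMap F K) := by
      by_contra hn
      have hcop : IsCoprime ((Polynomial.X - Polynomial.C α) ^ 2) (q.map (algebraMap F K)) :=
        ((irreducible_X_sub_C α).coprime_iff_not_dvd.2 hn).pow_left
      rw [Polynomial.map_mul] at h1
      have hu := hsep.squarefree _ (by simpa [pow_two] using hcop.dvd_of_dvd_mul_right h1)
      exact not_isUnit_X_sub_C α hu
    refine minpoly.not_isUnit F α (h _ ?_ (hroot g h2))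
    rw [pow_two]
    exact mul_dvd_mul_left _ (hroot q hq)
  · intro h D h1 h2
    by_contra hD
    have hD0 : D ≠ 0 := by
      rintro rfl
      simp at h1
      exact hf h1
    have hdeg : (D.map (algebraMap F K)).degree ≠ 0 := by
      rw [degree_map]
      exact fun h0 => hD (isUnit_iff_degree_eq_zero.2 h0)
    obtain ⟨α, hα⟩ := IsAlgClosed.exists_root _ hdeg
    have hα' := dvd_iff_isRoot.2 hα
    refine h α ⟨(pow_dvd_pow_of_dvd hα' 2).trans ?_, hα'.trans (Polynomial.map_dvd _ h2)⟩
    rw [← Polynomial.map_pow]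
    exact Polynomial.map_dvd _ h1

open Polynomial in
theorem goodPair_degreeLTEquiv_iff {F : Type*} [Field F] [PerfectField F] {n : ℕ} (hn : 2 ≤ n)
    (f g : degreeLT F (n + 1)) :
    GoodPair (degreeLTEquiv F (n + 1) f) (degreeLTEquiv F (n + 1) g) ↔
      (f : F[X]) ≠ 0 ∧ IsReducedPair (f : F[X]) g ∧
        ¬ ((f : F[X]).natDegree ≤ n - 2 ∧ (g : F[X]).natDegree ≤ n - 1) := by
  have hdeg (p : degreeLT F (n + 1)) : (p : F[X]).natDegree ≤ n :=
    natDegree_le_of_degree_le (Order.lt_succ_iff.1 (mem_degreeLT.1 p.2))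
  have hdeg' (p : degreeLT F (n + 1)) :
      ((p : F[X]).map (algebraMap F (AlgebraicClosure F))).natDegree ≤ n :=
    natDegree_map_le.trans (hdeg p)
  rw [GoodPair, form_degreeLTEquiv, form_degreeLTEquiv, ← homogenize_map, ← homogenize_map, Ne,
    homogenize_eq_zero_iff (hdeg f)]
  refine and_congr_right fun hf => ?_
  rw [isReducedPair_iff_forall_root (K := AlgebraicClosure F) hf]
  constructor
  · refine fun h => ⟨fun α => ?_, ?_⟩
    · have := h α 1 (Or.inr one_ne_zero)
      rw [← pow_one (lin α 1), ← pow_mul,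
        lin_pow_dvd_homogenize_iff (hdeg' f) one_ne_zero,
        lin_pow_dvd_homogenize_iff (hdeg' g) one_ne_zero] at this
      simpa using this
    · have := h 1 0 (Or.inl one_ne_zero)
      rw [← pow_one (lin 1 0), ← pow_mul,
        lin_zero_right_pow_dvd_homogenize_iff (hdeg' f) (by lia) one_ne_zero,
        lin_zero_right_pow_dvd_homogenize_iff (hdeg' g) (by lia) one_ne_zero] at this
      simpa using this
  · rintro ⟨h1, h2⟩ a b hab
    rw [← pow_one (lin a b), ← pow_mul]
    rcases eq_or_ne b 0 with rfl | hb
    · have ha : a ≠ 0 := by simpa using hab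
      rw [lin_zero_right_pow_dvd_homogenize_iff (hdeg' f) (by lia) ha,
        lin_zero_right_pow_dvd_homogenize_iff (hdeg' g) (by lia) ha]
      simpa using h2
    · rw [lin_pow_dvd_homogenize_iff (hdeg' f) hb, lin_pow_dvd_homogenize_iff (hdeg' g) hb]
      simpa using h1 (a / b)

open Polynomial in
theorem IsReducedPair.dvd_of_sq_mul_eq {F : Type*} [Field F] {D E f g f' g' : F[X]}
    (h : IsReducedPair f g) (hD : D ≠ 0) (hf : D ^ 2 * f = E ^ 2 * f') (hg : D * g = E * g') :
    E ∣ D := by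
  classical
  obtain ⟨a, b, ha, hb, hab⟩ := extract_gcd D E
  have hh : gcd D E ≠ 0 := fun h0 => hD ((gcd_eq_zero_iff _ _).1 h0).1
  generalize gcd D E = c at ha hb hh
  subst ha hb
  rw [gcd_isUnit_iff] at hab
  have h1 : a ^ 2 * f = b ^ 2 * f' :=
    mul_left_cancel₀ (pow_ne_zero 2 hh) (by linear_combination hf)
  have h2 : a * g = b * g' := mul_left_cancel₀ hh (by linear_combination hg)
  have hb : IsUnit b := h b (hab.symm.pow.dvd_of_dvd_mul_left (Dvd.intro _ h1.symm))
    (hab.symm.dvd_of_dvd_mul_left (Dvd.intro _ h2.symm))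
  exact mul_dvd_mul_left _ hb.dvd

open Polynomial in
theorem exists_monic_isReducedPair {F : Type*} [Field F] {f g : F[X]} (hf : f ≠ 0) :
    ∃ D f' g' : F[X], D.Monic ∧ D ^ 2 * f' = f ∧ D * g' = g ∧ IsReducedPair f' g' := by
  induction hn : f.natDegree using Nat.strong_induction_on generalizing f g with
  | _ n ih =>
    subst hn
    by_cases h : IsReducedPair f g
    · exact ⟨1, f, g, monic_one, by simp, by simp, h⟩
    · simp only [IsReducedPair, not_forall] at h
      obtain ⟨E, ⟨f₁, rfl⟩, ⟨g₁, rfl⟩, hE⟩ := h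
      have hE0 : E ≠ 0 := by rintro rfl; simp at hf
      have hf₁ : f₁ ≠ 0 := by rintro rfl; simp at hf
      have hlt : f₁.natDegree < (E ^ 2 * f₁).natDegree := by
        rw [natDegree_mul (pow_ne_zero 2 hE0) hf₁, natDegree_pow]
        have := natDegree_pos_iff_degree_pos.2 (degree_pos_of_ne_zero_of_nonunit hE0 hE)
        lia
      obtain ⟨D, f', g', hD, rfl, rfl, h'⟩ := ih _ hlt (g := g₁) hf₁ rfl
      have hc : E.leadingCoeff ≠ 0 := leadingCoeff_ne_zero.2 hE0
      refine ⟨Polynomial.C E.leadingCoeff⁻¹ * E * D, Polynomial.C E.leadingCoeff ^ 2 * f',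
        Polynomial.C E.leadingCoeff * g', ?_, ?_, ?_, ?_⟩
      · refine Monic.mul ?_ hD
        rw [mul_comm]
        exact monic_mul_leadingCoeff_inv hE0
      · have : Polynomial.C E.leadingCoeff⁻¹ * Polynomial.C E.leadingCoeff = 1 := by
          rw [← Polynomial.C_mul, inv_mul_cancel₀ hc, Polynomial.C_1]
        linear_combination (E ^ 2 * D ^ 2 * f') *
          (Polynomial.C E.leadingCoeff⁻¹ * Polynomial.C E.leadingCoeff + 1) * this
      · have : Polynomial.C E.leadingCoeff⁻¹ * Polynomial.C E.leadingCoeff = 1 := by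
          rw [← Polynomial.C_mul, inv_mul_cancel₀ hc, Polynomial.C_1]
        linear_combination (E * D * g') * this
      · have hu : IsUnit (Polynomial.C E.leadingCoeff) := isUnit_C.2 (isUnit_iff_ne_zero.2 hc)
        exact fun A h1 h2 => h' A ((hu.pow 2).dvd_mul_left.1 h1) (hu.dvd_mul_left.1 h2)

open Polynomial in
/-- The reduced pairs `(f, g)` with `f` of degree `m` and `g` of degree less than `k`. -/
def reducedPairs (F : Type*) [Field F] (m k : ℕ) : Set (F[X] × F[X]) :=
  {p | p.1.degree = m ∧ p.2.degree < k ∧ IsReducedPair p.1 p.2}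

open Polynomial in
theorem degree_lt_succ_iff {F : Type*} [Field F] (f : F[X]) (m : ℕ) :
    f.degree < (m + 1 : ℕ) ↔ f.degree ≤ m := by
  rw [degree_lt_iff_coeff_zero, degree_le_iff_coeff_zero]
  simp

open Polynomial in
theorem ncard_degree_lt (F : Type*) [Field F] (k : ℕ) :
    {f : F[X] | f.degree < k}.ncard = Nat.card F ^ k := by
  have : {f : F[X] | f.degree < k} = (degreeLT F k : Set F[X]) := by
    ext f; simp [mem_degreeLT]
  rw [this, ← Nat.card_coe_set_eq]
  exact (Nat.card_congr (degreeLTEquiv F k).toEquiv).trans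
    (by rw [Nat.card_fun, Nat.card_fin])

open Polynomial in
theorem finite_degree_lt (F : Type*) [Field F] [Finite F] (k : ℕ) :
    {f : F[X] | f.degree < k}.Finite :=
  Set.finite_of_ncard_pos (by rw [ncard_degree_lt]; exact pow_pos Nat.card_pos k)

open Polynomial in
theorem ncard_degree_eq (F : Type*) [Field F] [Finite F] (m : ℕ) :
    ({f : F[X] | f.degree = m}.ncard : ℝ) = ((Nat.card F : ℝ) - 1) * Nat.card F ^ m := by
  have hu : {f : F[X] | f.degree < (m + 1 : ℕ)} =
      {f : F[X] | f.degree < m} ∪ {f : F[X] | f.degree = m} := by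
    ext f
    simp only [Set.mem_ofPred_eq, Set.mem_union, ← le_iff_lt_or_eq, degree_lt_succ_iff]
  have hd : Disjoint {f : F[X] | f.degree < m} {f : F[X] | f.degree = m} :=
    Set.disjoint_left.2 fun f h h' => h.ne h'
  have hfin := finite_degree_lt F (m + 1)
  rw [hu] at hfin
  have := Set.ncard_union_eq hd (hfin.subset Set.subset_union_left)
    (hfin.subset Set.subset_union_right)
  rw [← hu, ncard_degree_lt, ncard_degree_lt] at this
  have h' : (Nat.card F : ℝ) ^ (m + 1) =
      Nat.card F ^ m + ({f : F[X] | f.degree = m}.ncard : ℝ) := mod_cast this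
  linear_combination -h'

open Polynomial in
theorem reducedPairs_finite (F : Type*) [Field F] [Finite F] (m k : ℕ) :
    (reducedPairs F m k).Finite :=
  ((finite_degree_lt F (m + 1)).prod (finite_degree_lt F k)).subset fun _ hp =>
    ⟨(degree_lt_succ_iff _ _).2 hp.1.le, hp.2.1⟩

open Polynomial in
theorem ncard_prod_eq_sum_reducedPairs (F : Type*) [Field F] [Finite F] {m k : ℕ}
    (h : m ≤ 2 * k) :
    {f : F[X] | f.degree = m}.ncard * Nat.card F ^ k =
      ∑ d ∈ Finset.range (m / 2 + 1),
        Nat.card F ^ d * (reducedPairs F (m - 2 * d) (k - d)).ncard := by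
  rw [← ncard_degree_lt, ← Set.ncard_prod, ← Nat.card_coe_set_eq]
  have hcard (d : ℕ) : Nat.card {D : F[X] // D.Monic ∧ D.natDegree = d} = Nat.card F ^ d := by
    rw [Nat.card_congr ((monicEquivDegreeLT d).trans (degreeLTEquiv F d).toEquiv), Nat.card_fun,
      Nat.card_fin]
  have hfin (d : ℕ) : Finite {D : F[X] // D.Monic ∧ D.natDegree = d} :=
    Nat.finite_of_card_ne_zero (by rw [hcard]; exact (pow_pos Nat.card_pos d).ne')
  have hfin' (m k : ℕ) : Finite (reducedPairs F m k) := (reducedPairs_finite F m k).to_subtype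
  have hmem (x : Σ d : Fin (m / 2 + 1), {D : F[X] // D.Monic ∧ D.natDegree = d} ×
      reducedPairs F (m - 2 * d) (k - d)) :
      ((x.2.1 : F[X]) ^ 2 * x.2.2.1.1, (x.2.1 : F[X]) * x.2.2.1.2) ∈
        {f : F[X] | f.degree = m} ×ˢ {f : F[X] | f.degree < k} := by
    obtain ⟨⟨d, hlt⟩, ⟨D, hD, hd⟩, ⟨f, g⟩, hf, hg, -⟩ := x
    dsimp only at hd hf hg ⊢
    subst hd
    constructor
    · simp only [Set.mem_ofPred_eq, degree_mul, degree_pow, hf, degree_eq_natDegree hD.ne_zero,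
        nsmul_eq_mul]
      exact_mod_cast (by lia : 2 * D.natDegree + (m - 2 * D.natDegree) = m)
    · simp only [Set.mem_ofPred_eq, degree_mul, degree_eq_natDegree hD.ne_zero]
      rcases eq_or_ne g 0 with rfl | hg0
      · simp
      · rw [degree_eq_natDegree hg0] at hg ⊢
        norm_cast at hg ⊢
        lia
  have hbij : Function.Bijective fun x => (⟨_, hmem x⟩ : ↥({f : F[X] | f.degree = m} ×ˢ
      {f : F[X] | f.degree < k})) := by
    constructor
    · rintro ⟨⟨d, hlt⟩, ⟨D, hD, hd⟩, ⟨f, g⟩, hf, hg, hr⟩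
        ⟨⟨d', hlt'⟩, ⟨E, hE, hd'⟩, ⟨f', g'⟩, hf', hg', hr'⟩ heq
      simp only [Subtype.mk.injEq, Prod.mk.injEq] at heq hd hd' hr hr'
      subst hd hd'
      obtain ⟨h1, h2⟩ := heq
      obtain rfl : D = E := eq_of_monic_of_associated hD hE
        (associated_of_dvd_dvd (hr'.dvd_of_sq_mul_eq hE.ne_zero h1.symm h2.symm)
          (hr.dvd_of_sq_mul_eq hD.ne_zero h1 h2))
      obtain rfl := mul_left_cancel₀ (pow_ne_zero 2 hD.ne_zero) h1
      obtain rfl := mul_left_cancel₀ hD.ne_zero h2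
      rfl
    · rintro ⟨⟨f, g⟩, hf, hg⟩
      change f.degree = m at hf
      change g.degree < k at hg
      have hf0 : f ≠ 0 := by rintro rfl; simp at hf
      obtain ⟨D, f', g', hD, rfl, rfl, hr⟩ := exists_monic_isReducedPair (g := g) hf0
      have hf0' : f' ≠ 0 := right_ne_zero_of_mul hf0
      have hm : 2 * D.natDegree + f'.natDegree = m := by
        rw [degree_eq_natDegree hf0] at hf
        rw [← natDegree_pow, ← natDegree_mul (pow_ne_zero 2 hD.ne_zero) hf0']
        exact_mod_cast hf
      refine ⟨⟨⟨D.natDegree, by lia⟩, ⟨D, hD, rfl⟩, ⟨f', g'⟩, ?_, ?_, hr⟩, rfl⟩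
      · rw [degree_eq_natDegree hf0']
        norm_cast
        lia
      · rcases eq_or_ne g' 0 with rfl | hg0
        · simp
        · rw [degree_eq_natDegree (mul_ne_zero hD.ne_zero hg0),
            natDegree_mul hD.ne_zero hg0] at hg
          rw [degree_eq_natDegree hg0]
          norm_cast at hg ⊢
          lia
  rw [← Nat.card_congr (Equiv.ofBijective _ hbij), Nat.card_sigma, Finset.sum_range]
  exact Finset.sum_congr rfl fun d _ => by rw [Nat.card_prod, hcard, Nat.card_coe_set_eq]

theorem ncard_reducedPairs_of_le_one (F : Type*) [Field F] [Finite F] {m k : ℕ}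
    (hm : m ≤ 1) (h : m ≤ 2 * k) :
    ((reducedPairs F m k).ncard : ℝ) =
      ((Nat.card F : ℝ) - 1) * Nat.card F ^ m * Nat.card F ^ k := by
  have := ncard_prod_eq_sum_reducedPairs F h
  rw [Nat.div_eq_of_lt (by lia)] at this
  rw [← ncard_degree_eq]
  simpa using (congrArg (Nat.cast (R := ℝ)) this).symm

theorem ncard_reducedPairs_add_two (F : Type*) [Field F] [Finite F] {m k : ℕ}
    (h : m ≤ 2 * k) :
    ((reducedPairs F (m + 2) (k + 1)).ncard : ℝ) =
      ((Nat.card F : ℝ) - 1) * Nat.card F ^ (m + k + 1) * (Nat.card F ^ 2 - 1) := by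
  have h1 := ncard_prod_eq_sum_reducedPairs F (m := m + 2) (k := k + 1) (by lia)
  have h2 := ncard_prod_eq_sum_reducedPairs F h
  have hs : ∑ d ∈ Finset.range (m / 2 + 1), Nat.card F ^ (d + 1) *
      (reducedPairs F (m + 2 - 2 * (d + 1)) (k + 1 - (d + 1))).ncard =
      Nat.card F * ∑ d ∈ Finset.range (m / 2 + 1), Nat.card F ^ d *
        (reducedPairs F (m - 2 * d) (k - d)).ncard := by
    rw [Finset.mul_sum]
    refine Finset.sum_congr rfl fun d _ => ?_
    rw [show m + 2 - 2 * (d + 1) = m - 2 * d by lia, Nat.add_sub_add_right]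
    ring
  rw [show (m + 2) / 2 = m / 2 + 1 by lia, Finset.sum_range_succ', hs, ← h2] at h1
  replace h1 := congrArg (Nat.cast (R := ℝ)) h1
  simp only [Nat.cast_mul, Nat.cast_add (R := ℝ), Nat.cast_pow, ncard_degree_eq, mul_zero,
    Nat.sub_zero, pow_zero, one_mul] at h1
  linear_combination -h1

open Polynomial in
/-- The reduced pairs `(f, g)` with `f` nonzero of degree less than `N` and `g` of degree less
than `k`. -/
def reducedPairsLT (F : Type*) [Field F] (N k : ℕ) : Set (F[X] × F[X]) :=
  {p | p.1 ≠ 0 ∧ p.1.degree < N ∧ p.2.degree < k ∧ IsReducedPair p.1 p.2}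

open Polynomial in
theorem reducedPairsLT_finite (F : Type*) [Field F] [Finite F] (N k : ℕ) :
    (reducedPairsLT F N k).Finite :=
  ((finite_degree_lt F N).prod (finite_degree_lt F k)).subset fun _ hp => ⟨hp.2.1, hp.2.2.1⟩

open Polynomial in
theorem ncard_reducedPairsLT_succ (F : Type*) [Field F] [Finite F] (N k : ℕ) :
    (reducedPairsLT F (N + 1) k).ncard =
      (reducedPairsLT F N k).ncard + (reducedPairs F N k).ncard := by
  rw [← Set.ncard_union_eq _ (reducedPairsLT_finite F N k) (reducedPairs_finite F N k)]
  · congr 1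
    ext p
    have h1 : p.1.degree < (N + 1 : ℕ) ↔ p.1.degree < N ∨ p.1.degree = N := by
      rw [← le_iff_lt_or_eq, degree_lt_succ_iff]
    have h2 : p.1.degree = N → p.1 ≠ 0 := fun h h0 => by simp [h0] at h
    simp only [reducedPairsLT, reducedPairs, Set.mem_union, Set.mem_ofPred_eq, h1]
    tauto
  · exact Set.disjoint_left.2 fun p h h' => h.2.1.ne h'.1

open Polynomial in
theorem ncard_reducedPairsLT_add_two (F : Type*) [Field F] [Finite F] {N k : ℕ}
    (h : N ≤ 2 * k + 1) :
    ((reducedPairsLT F (N + 2) (k + 1)).ncard : ℝ) =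
      Nat.card F ^ (N + k + 1) * ((Nat.card F : ℝ) ^ 2 - 1) := by
  induction N with
  | zero =>
    have h0 : reducedPairsLT F 0 (k + 1) = ∅ := by
      ext p
      simp only [reducedPairsLT, Set.mem_ofPred_eq, Set.mem_empty_iff_false, iff_false]
      rintro ⟨h1, h2, -⟩
      exact h1 (degree_eq_bot.1 (by simpa using h2))
    rw [ncard_reducedPairsLT_succ, ncard_reducedPairsLT_succ, h0]
    push_cast
    rw [ncard_reducedPairs_of_le_one F (by lia) (by lia),
      ncard_reducedPairs_of_le_one F (by lia) (by lia)]
    simp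
    ring
  | succ N ih =>
    rw [ncard_reducedPairsLT_succ]
    push_cast
    rw [ih (by lia), ncard_reducedPairs_add_two F (by lia)]
    ring

open Polynomial in
theorem card_goodPair_eq {F : Type*} [Field F] [Finite F] {n : ℕ} (hn : 3 ≤ n) :
    Nat.card {p : (Fin (n + 1) → F) × (Fin (n + 1) → F) // GoodPair p.1 p.2} =
      (reducedPairsLT F (n + 1) (n + 1) \ reducedPairsLT F (n - 1) n).ncard := by
  have hlt (N : ℕ) (hN : 1 ≤ N) (p : F[X]) : p.natDegree ≤ N - 1 ↔ p.degree < N := by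
    rw [natDegree_le_iff_degree_le]
    obtain ⟨N, rfl⟩ := Nat.exists_eq_add_of_le' hN
    exact (degree_lt_succ_iff p N).symm
  let e := degreeLTEquiv F (n + 1)
  have hgood (c₁ c₂ : Fin (n + 1) → F) : GoodPair c₁ c₂ ↔
      ((e.symm c₁ : F[X]), (e.symm c₂ : F[X])) ∈
        reducedPairsLT F (n + 1) (n + 1) \ reducedPairsLT F (n - 1) n := by
    have h1 := mem_degreeLT.1 (e.symm c₁).2
    have h2 := mem_degreeLT.1 (e.symm c₂).2
    have := goodPair_degreeLTEquiv_iff (by lia) (e.symm c₁) (e.symm c₂)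
    rw [e.apply_symm_apply, e.apply_symm_apply, show n - 2 = n - 1 - 1 by lia, hlt _ (by lia),
      hlt _ (by lia)] at this
    rw [this]
    simp only [reducedPairsLT, Set.mem_sdiff, Set.mem_ofPred_eq]
    tauto
  rw [← Nat.card_coe_set_eq]
  refine Nat.card_congr (Equiv.ofBijective
    (fun x => ⟨((e.symm x.1.1 : F[X]), (e.symm x.1.2 : F[X])), (hgood _ _).1 x.2⟩) ⟨?_, ?_⟩)
  · rintro ⟨⟨c₁, c₂⟩, h⟩ ⟨⟨d₁, d₂⟩, h'⟩ heq
    simp only [Subtype.mk.injEq, Prod.mk.injEq, Subtype.coe_inj, e.symm.injective.eq_iff] at heq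
    simpa using heq
  · rintro ⟨⟨f, g⟩, h⟩
    have hf : f ∈ degreeLT F (n + 1) := mem_degreeLT.2 h.1.2.1
    have hg : g ∈ degreeLT F (n + 1) := mem_degreeLT.2 h.1.2.2.1
    exact ⟨⟨(e ⟨f, hf⟩, e ⟨g, hg⟩), (hgood _ _).2 (by simpa using h)⟩, by simp⟩

/-- A dual number is the pair of its components. -/
theorem card_goodPair_dualNumber {F : Type*} [Field F] (n : ℕ) :
    Nat.card {p : (Fin (n + 1) → F) × (Fin (n + 1) → F) // GoodPair p.1 p.2} =
      Nat.card {f : Fin (n + 1) → DualNumber F //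
        GoodPair (fun i => (f i).fst) (fun i => (f i).snd)} :=
  Nat.card_congr ((Equiv.arrowProdEquivProdArrow (Fin (n + 1)) (fun _ => F)
    (fun _ => F)).symm.subtypeEquiv fun _ => Iff.rfl)

theorem stmt10 (F : Type*) [Field F] [Fintype F] (Q n : ℕ)
    (hQ : Fintype.card F = Q) (hn : 1 ≤ n) :
    Nat.card {p : (Fin (n + 1) → F) × (Fin (n + 1) → F) // GoodPair p.1 p.2} =
      Nat.card {f : Fin (n + 1) → DualNumber F //
        GoodPair (fun i => (f i).fst) (fun i => (f i).snd)} ∧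
    (3 ≤ n →
      (Nat.card {p : (Fin (n + 1) → F) × (Fin (n + 1) → F) // GoodPair p.1 p.2} : ℝ) =
        (Q : ℝ) ^ (2 * n + 2) *
          (1 - (Q : ℝ) ^ (-2 : ℤ) - (Q : ℝ) ^ (-3 : ℤ) + (Q : ℝ) ^ (-5 : ℤ))) := by
  refine ⟨card_goodPair_dualNumber n, fun h3 => ?_⟩
  obtain ⟨m, rfl⟩ := Nat.exists_eq_add_of_le' h3
  have hsub : reducedPairsLT F (m + 2) (m + 3) ⊆ reducedPairsLT F (m + 4) (m + 4) :=
    fun p hp => ⟨hp.1, hp.2.1.trans_le (by norm_cast; lia),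
      hp.2.2.1.trans_le (by norm_cast; lia), hp.2.2.2⟩
  have hQ0 : (Q : ℝ) ≠ 0 := by
    rw [← hQ]
    exact_mod_cast Fintype.card_ne_zero
  rw [card_goodPair_eq h3, show m + 3 - 1 = m + 2 by lia,
    Set.cast_ncard_sdiff hsub (reducedPairsLT_finite F _ _),
    ncard_reducedPairsLT_add_two F (N := m + 2) (k := m + 3) (by lia),
    ncard_reducedPairsLT_add_two F (N := m) (k := m + 2) (by lia),
    Nat.card_eq_fintype_card, hQ]
  simp only [zpow_neg]
  norm_cast
  push_cast
  field_simp
  ring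
end

section
/- Let Q be a finite field with Q elements. The proportion of binary forms of degree n ≥ 3 over Q that are squarefree (i.e., have no repeated geometric root in P^1) equals 1 - Q^{-1} - Q^{-2} + Q^{-3}. -/
open MvPolynomial

/-- A binary form is squarefree: it is nonzero and has no geometric root of
multiplicity at least `2` on `P^1` (including at infinity). -/
def SqfreeForm {F : Type*} [Field F] {n : ℕ} (c : Fin (n + 1) → F) : Prop :=
  form F n c ≠ 0 ∧ ∀ a b : AlgebraicClosure F, (a ≠ 0 ∨ b ≠ 0) →
    ¬ (lin a b ^ 2 ∣ (form F n c).map (algebraMap F (AlgebraicClosure F)))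

section SquareParts

open Polynomial

variable {F : Type*} [Field F]

theorem dvd_of_sq_dvd_sq_mul_squarefree {x y b : F[X]} (hy : y ≠ 0) (hb : Squarefree b)
    (h : x ^ 2 ∣ y ^ 2 * b) : x ∣ y := by
  classical
  obtain ⟨x', y', hunit, hx, hy'⟩ : ∃ x' y', IsCoprime x' y' ∧
      x = EuclideanDomain.gcd x y * x' ∧ y = EuclideanDomain.gcd x y * y' := by
    obtain ⟨x', hx⟩ := EuclideanDomain.gcd_dvd_left x y
    obtain ⟨y', hy'⟩ := EuclideanDomain.gcd_dvd_right x y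
    refine ⟨x', y', ?_, hx, hy'⟩
    have hd : EuclideanDomain.gcd x y ≠ 0 := fun h0 => hy (by rw [hy', h0, zero_mul])
    refine ⟨EuclideanDomain.gcdA x y, EuclideanDomain.gcdB x y, mul_left_cancel₀ hd ?_⟩
    have := EuclideanDomain.gcd_eq_gcd_ab x y
    linear_combination EuclideanDomain.gcdA x y * -hx + EuclideanDomain.gcdB x y * -hy' - this
  set d := EuclideanDomain.gcd x y
  have hd : d ≠ 0 := by
    rintro h0
    exact hy (by rw [hy', h0, zero_mul])
  have h1 : x' ^ 2 ∣ y' ^ 2 * b := by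
    rw [hx, hy', mul_pow, mul_pow, mul_assoc] at h
    exact (mul_dvd_mul_iff_left (pow_ne_zero 2 hd)).1 h
  have h2 : x' * x' ∣ b := by
    rw [← sq]
    exact (hunit.pow (m := 2) (n := 2)).dvd_of_dvd_mul_left h1
  have h3 : IsUnit x' := hb _ h2
  rw [hx, hy']
  exact mul_dvd_mul_left _ h3.dvd

theorem eq_of_sq_mul_squarefree_eq {a a' b b' : F[X]} (ha : a.Monic) (ha' : a'.Monic)
    (hb : Squarefree b) (hb' : Squarefree b') (h : a ^ 2 * b = a' ^ 2 * b') :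
    a = a' ∧ b = b' := by
  have haa : a = a' := eq_of_monic_of_associated ha ha' <| associated_of_dvd_dvd
    (dvd_of_sq_dvd_sq_mul_squarefree ha'.ne_zero hb' (h ▸ dvd_mul_right _ _))
    (dvd_of_sq_dvd_sq_mul_squarefree ha.ne_zero hb (h ▸ dvd_mul_right _ _))
  subst haa
  exact ⟨rfl, mul_left_cancel₀ (pow_ne_zero 2 ha.ne_zero) h⟩

theorem exists_monic_sq_mul_squarefree {g : F[X]} (hg : g ≠ 0) :
    ∃ a b : F[X], a.Monic ∧ Squarefree b ∧ g = a ^ 2 * b := by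
  induction hd : g.natDegree using Nat.strong_induction_on generalizing g with
  | _ d ih =>
    by_cases hs : Squarefree g
    · exact ⟨1, g, monic_one, hs, by simp⟩
    · obtain ⟨x, hxg, hx⟩ : ∃ x, x * x ∣ g ∧ ¬ IsUnit x := by
        simpa [Squarefree] using hs
      obtain ⟨h, rfl⟩ := hxg
      have hx0 : x ≠ 0 := by rintro rfl; simp at hg
      have hh0 : h ≠ 0 := by rintro rfl; simp at hg
      have hxd : 0 < x.natDegree := natDegree_pos_iff_degree_pos.2 (degree_pos_of_ne_zero_of_nonunit hx0 hx)
      have hdeg : (x * x * h).natDegree = x.natDegree + x.natDegree + h.natDegree := by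
        rw [natDegree_mul (mul_ne_zero hx0 hx0) hh0, natDegree_mul hx0 hx0]
      set c := x.leadingCoeff
      have hc : c ≠ 0 := leadingCoeff_ne_zero.2 hx0
      obtain ⟨a, b, ha, hb, hab⟩ := ih h.natDegree (by omega) (g := Polynomial.C (c ^ 2) * h)
        (mul_ne_zero (by simpa using hc) hh0) (natDegree_C_mul (pow_ne_zero 2 hc))
      refine ⟨x * Polynomial.C c⁻¹ * a, b, (monic_mul_leadingCoeff_inv hx0).mul ha, hb, ?_⟩
      have hcc : Polynomial.C c⁻¹ * Polynomial.C c = (1 : F[X]) := by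
        rw [← Polynomial.C_mul, inv_mul_cancel₀ hc, Polynomial.C_1]
      rw [mul_pow, mul_assoc (_ ^ 2), ← hab, Polynomial.C_pow]
      linear_combination (-x ^ 2 * h * (1 + Polynomial.C c⁻¹ * Polynomial.C c)) * hcc

/-- Nonzero polynomials of degree `m` or `m + 1`. -/
def degreeWindow (F : Type*) [Field F] (m : ℕ) : Set F[X] :=
  (degreeLT F (m + 2) : Set F[X]) \ degreeLT F m

theorem mem_degreeWindow {m : ℕ} {p : F[X]} :
    p ∈ degreeWindow F m ↔ p ≠ 0 ∧ m ≤ p.natDegree ∧ p.natDegree < m + 2 := by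
  by_cases hp : p = 0
  · simp [degreeWindow, hp]
  · simp only [degreeWindow, Set.mem_sdiff, SetLike.mem_coe, mem_degreeLT,
      degree_eq_natDegree hp]
    norm_cast
    simp only [hp, not_false_eq_true, true_and]
    omega

theorem ncard_degreeLT (m : ℕ) : (degreeLT F m : Set F[X]).ncard = Nat.card F ^ m := by
  rw [← Nat.card_coe_set_eq]
  simpa [Nat.card_fun] using Nat.card_congr (degreeLTEquiv F m).toEquiv

theorem finite_degreeLT [Finite F] (m : ℕ) : (degreeLT F m : Set F[X]).Finite :=
  Finite.of_equiv _ (degreeLTEquiv F m).toEquiv.symm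

theorem ncard_degreeWindow_add [Finite F] (m : ℕ) :
    (degreeWindow F m).ncard + Nat.card F ^ m = Nat.card F ^ (m + 2) := by
  rw [← ncard_degreeLT, ← ncard_degreeLT]
  exact Set.ncard_sdiff_add_ncard_of_subset (degreeLT_mono (by omega)) (finite_degreeLT _)

theorem ncard_not_squarefree_degreeWindow (m : ℕ) :
    {p ∈ degreeWindow F (m + 2) | ¬ Squarefree p}.ncard =
      Nat.card F * (degreeWindow F m).ncard := by
  choose! a b ha hb hab using fun (g : F[X]) (hg : g ≠ 0) => exists_monic_sq_mul_squarefree hg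
  rw [← Set.ncard_univ, ← Set.ncard_prod]
  have hmon : ∀ {q : F[X]}, q.Monic → ∀ c : F,
      (Polynomial.X * q + Polynomial.C c).Monic ∧ (Polynomial.X * q + Polynomial.C c).natDegree = q.natDegree + 1 := by
    intro q hq c
    have hX : (Polynomial.X * q).Monic := monic_X.mul hq
    have hd : (Polynomial.X * q).natDegree = q.natDegree + 1 := by
      rw [natDegree_X_mul hq.ne_zero]
    refine ⟨hX.add_of_left ?_, by rw [natDegree_add_C, hd]⟩
    refine degree_C_le.trans_lt ?_
    rw [degree_eq_natDegree hX.ne_zero, hd]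
    exact_mod_cast Nat.succ_pos _
  symm
  refine Set.ncard_congr (fun x _ => (Polynomial.X * a x.2 + Polynomial.C x.1) ^ 2 * b x.2) ?_ ?_ ?_
  · rintro ⟨c, g⟩ ⟨-, hg⟩
    rw [mem_degreeWindow] at hg
    dsimp only at hg
    obtain ⟨h1, h2⟩ := hmon (ha g hg.1) c
    have hb0 := (hb g hg.1).ne_zero
    have hgd : g.natDegree = 2 * (a g).natDegree + (b g).natDegree := by
      conv_lhs => rw [hab g hg.1]
      rw [natDegree_mul (pow_ne_zero 2 (ha g hg.1).ne_zero) hb0, natDegree_pow]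
    refine ⟨?_, fun hs => ?_⟩
    · rw [mem_degreeWindow]
      refine ⟨mul_ne_zero (pow_ne_zero 2 h1.ne_zero) hb0, ?_⟩
      rw [natDegree_mul (pow_ne_zero 2 h1.ne_zero) hb0, natDegree_pow, h2]
      omega
    · have := hs _ ((sq _).symm.dvd.trans (dvd_mul_right _ _))
      have := natDegree_eq_zero_of_isUnit this
      simp only at this
      omega
  · rintro ⟨c, g⟩ ⟨c', g'⟩ ⟨-, hg⟩ ⟨-, hg'⟩ h
    have hg := (mem_degreeWindow.1 hg).1
    have hg' := (mem_degreeWindow.1 hg').1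
    obtain ⟨h1, h2⟩ := eq_of_sq_mul_squarefree_eq (hmon (ha g hg) c).1 (hmon (ha g' hg') c').1
      (hb g hg) (hb g' hg') h
    have hc : c = c' := by simpa using congrArg (Polynomial.coeff · 0) h1
    subst hc
    have haa : a g = a g' := mul_left_cancel₀ X_ne_zero (add_right_cancel h1)
    rw [Prod.mk.injEq, hab g hg, hab g' hg', haa]
    exact ⟨rfl, congrArg _ h2⟩
  · rintro p ⟨hp, hns⟩
    rw [mem_degreeWindow] at hp
    obtain ⟨y, z, hy, hz, rfl⟩ := exists_monic_sq_mul_squarefree hp.1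
    have hy0 : y.natDegree ≠ 0 := by
      intro h0
      rw [hy.natDegree_eq_zero.1 h0] at hns
      simp [hz] at hns
    have hyX : Polynomial.X * y.divX + Polynomial.C (y.coeff 0) = y := by
      rw [mul_comm]; exact divX_mul_X_add y
    have hyd : y.divX.Monic := by
      rw [Monic, leadingCoeff, natDegree_divX_eq_natDegree_tsub_one, coeff_divX,
        Nat.sub_add_cancel (Nat.pos_of_ne_zero hy0)]
      exact hy
    have hg0 : y.divX ^ 2 * z ≠ 0 := mul_ne_zero (pow_ne_zero 2 hyd.ne_zero) hz.ne_zero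
    obtain ⟨h1, h2⟩ := eq_of_sq_mul_squarefree_eq (ha _ hg0) hyd (hb _ hg0) hz (hab _ hg0).symm
    refine ⟨(y.coeff 0, y.divX ^ 2 * z), ⟨Set.mem_univ _, ?_⟩, ?_⟩
    · rw [mem_degreeWindow]
      refine ⟨hg0, ?_⟩
      have := hp.2
      rw [natDegree_mul (pow_ne_zero 2 hy.ne_zero) hz.ne_zero, natDegree_pow] at this
      rw [natDegree_mul (pow_ne_zero 2 hyd.ne_zero) hz.ne_zero, natDegree_pow,
        natDegree_divX_eq_natDegree_tsub_one]
      omega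
    · simp only [h1, h2, hyX]

theorem ncard_squarefree_degreeWindow [Finite F] (m : ℕ) :
    {p ∈ degreeWindow F (m + 2) | Squarefree p}.ncard +
      Nat.card F * (degreeWindow F m).ncard = (degreeWindow F (m + 2)).ncard := by
  rw [← ncard_not_squarefree_degreeWindow]
  have hfin : (degreeWindow F (m + 2)).Finite := (finite_degreeLT _).sdiff
  rw [← Set.ncard_union_eq _ (hfin.subset (Set.sep_subset _ _))
    (hfin.subset (Set.sep_subset _ _))]
  · congr 1
    ext p
    simp only [Set.mem_union, Set.mem_ofPred_eq]
    tauto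
  · rw [Set.disjoint_left]
    exact fun p h1 h2 => h2.2 h1.2

end SquareParts

section Dehomogenization

variable {F : Type*} [Field F]

/-- The dehomogenization `F(X, 1)` of the binary form with coefficients `c`. -/
noncomputable def dehomogenized {n : ℕ} (c : Fin (n + 1) → F) : Polynomial F :=
  ((Polynomial.degreeLTEquiv F (n + 1)).symm c : Polynomial F)

theorem dehomogenized_mem {n : ℕ} (c : Fin (n + 1) → F) :
    dehomogenized c ∈ Polynomial.degreeLT F (n + 1) :=
  Subtype.property _

theorem natDegree_dehomogenized_le {n : ℕ} (c : Fin (n + 1) → F) :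
    (dehomogenized c).natDegree ≤ n := by
  have := Polynomial.mem_degreeLT.1 (dehomogenized_mem c)
  exact Polynomial.natDegree_le_of_degree_le (Order.lt_succ_iff.1 (by exact_mod_cast this))

theorem form_eq_homogenize {n : ℕ} (c : Fin (n + 1) → F) :
    form F n c = (dehomogenized c).homogenize n := by
  have : dehomogenized c = ∑ i : Fin (n + 1), Polynomial.C (c i) * Polynomial.X ^ (i : ℕ) := by
    simp [dehomogenized, Polynomial.degreeLTEquiv, Polynomial.C_mul_X_pow_eq_monomial]
  rw [this, Polynomial.homogenize_finsetSum, form]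
  refine Finset.sum_congr rfl fun i _ => ?_
  rw [Polynomial.homogenize_C_mul, Polynomial.homogenize_X_pow (by omega), mul_assoc]

theorem X_sq_dvd_homogenize_iff {K : Type*} [Field K] {p : Polynomial K} {m : ℕ}
    (hp : p.natDegree ≤ m + 2) :
    (X 1 : MvPolynomial (Fin 2) K) ^ 2 ∣ p.homogenize (m + 2) ↔ p.natDegree ≤ m := by
  constructor
  · rintro ⟨H, hH⟩
    rw [Polynomial.natDegree_le_iff_coeff_eq_zero]
    intro i hi
    by_cases hi' : m + 2 < i
    · exact Polynomial.coeff_eq_zero_of_natDegree_lt (by omega)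
    have h := congrArg
      (coeff (Finsupp.single 0 i + Finsupp.single 1 (m + 2 - i) : Fin 2 →₀ ℕ)) hH
    rw [Polynomial.coeff_homogenize, X_pow_eq_monomial, coeff_monomial_mul',
      if_pos (by simp; omega), if_neg] at h
    · simpa using h
    · intro hle
      have := hle 1
      simp at this
      omega
  · intro h
    refine Dvd.intro_left (p.homogenize m) ?_
    have := Polynomial.homogenize_mul p 1 h (Polynomial.natDegree_one.trans_le (Nat.zero_le 2))
    rw [mul_one, Polynomial.homogenize_one] at this
    exact this.symm

theorem lin_sq_dvd_homogenize_of_sq_dvd {K : Type*} [Field K] {p : Polynomial K} {m : ℕ}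
    (hp : p.natDegree ≤ m + 2) (hp0 : p ≠ 0) {x : K}
    (h : (Polynomial.X - Polynomial.C x) ^ 2 ∣ p) :
    lin x 1 ^ 2 ∣ p.homogenize (m + 2) := by
  obtain ⟨r, rfl⟩ := h
  have hX : (Polynomial.X - Polynomial.C x : Polynomial K).natDegree ≤ 1 :=
    (Polynomial.natDegree_X_sub_C x).le
  have hr0 : r ≠ 0 := right_ne_zero_of_mul hp0
  have hq0 : (Polynomial.X - Polynomial.C x : Polynomial K) ^ 2 ≠ 0 := left_ne_zero_of_mul hp0
  have hdeg : ((Polynomial.X - Polynomial.C x : Polynomial K) ^ 2).natDegree = 2 := by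
    rw [Polynomial.natDegree_pow, Polynomial.natDegree_X_sub_C]
  have hr : r.natDegree ≤ m := by
    rw [Polynomial.natDegree_mul hq0 hr0, hdeg] at hp
    omega
  have hlin : (Polynomial.X - Polynomial.C x : Polynomial K).homogenize 1 = lin x 1 := by
    simp [lin]
  have hsq : ((Polynomial.X - Polynomial.C x : Polynomial K) ^ 2).homogenize 2 =
      lin x 1 ^ 2 := by
    rw [sq, sq, ← hlin]
    exact Polynomial.homogenize_mul _ _ hX hX
  rw [add_comm m, Polynomial.homogenize_mul _ _ hdeg.le hr, hsq]
  exact dvd_mul_right _ _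

theorem lin_sq_dvd_dehomogenize {K : Type*} [Field K] {p : Polynomial K} {n : ℕ}
    (hp : p.natDegree ≤ n) {a b : K} (h : lin a b ^ 2 ∣ p.homogenize n) :
    (Polynomial.C b * Polynomial.X - Polynomial.C a) ^ 2 ∣ p := by
  have := map_dvd (aeval ![Polynomial.X, (1 : Polynomial K)]) h
  rw [Polynomial.aeval_homogenize_X_one _ hp] at this
  simpa [lin, Polynomial.C_eq_algebraMap] using this

theorem sqfreeForm_iff [PerfectField F] {m : ℕ} (c : Fin (m + 2 + 1) → F) :
    SqfreeForm c ↔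
      dehomogenized c ∈ degreeWindow F (m + 1) ∧ Squarefree (dehomogenized c) := by
  have hn := natDegree_dehomogenized_le c
  rw [SqfreeForm, form_eq_homogenize, ← Polynomial.homogenize_map, mem_degreeWindow, ne_eq,
    Polynomial.homogenize_eq_zero_iff hn]
  generalize dehomogenized c = p at hn ⊢
  set f := algebraMap F (AlgebraicClosure F)
  have hn' : (p.map f).natDegree ≤ m + 2 := Polynomial.natDegree_map_le.trans hn
  constructor
  · rintro ⟨hp, h⟩
    refine ⟨⟨hp, ?_, by omega⟩, ?_⟩
    · by_contra hlt
      refine h 1 0 (by simp) ?_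
      have : (lin 1 0 : MvPolynomial (Fin 2) (AlgebraicClosure F)) ^ 2 = X 1 ^ 2 := by
        simp [lin]
      rw [this, X_sq_dvd_homogenize_iff hn', Polynomial.natDegree_map]
      omega
    · intro q hq
      by_contra hu
      have hq0 : q ≠ 0 := by
        rintro rfl
        exact hp (by simpa using hq)
      obtain ⟨x, hx⟩ := IsAlgClosed.exists_aeval_eq_zero (AlgebraicClosure F) q
        (Polynomial.degree_pos_of_ne_zero_of_nonunit hq0 hu).ne'
      refine h x 1 (by simp) (lin_sq_dvd_homogenize_of_sq_dvd hn'
        (by rwa [Polynomial.map_ne_zero_iff f.injective]) ?_)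
      have h1 : Polynomial.X - Polynomial.C x ∣ q.map f := by
        rw [Polynomial.dvd_iff_isRoot, Polynomial.IsRoot, Polynomial.eval_map_algebraMap, hx]
      calc _ ∣ (q.map f) ^ 2 := pow_dvd_pow_of_dvd h1 2
        _ ∣ p.map f := by
          rw [sq, ← Polynomial.map_mul]
          exact Polynomial.map_dvd f hq
  · rintro ⟨⟨hp, hd, -⟩, hs⟩
    refine ⟨hp, fun a b hab h => ?_⟩
    by_cases hb : b = 0
    · subst hb
      have ha : a ≠ 0 := by simpa using hab
      have hX : (X 1 : MvPolynomial (Fin 2) (AlgebraicClosure F)) ^ 2 ∣ lin a 0 ^ 2 := by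
        simp [lin, mul_pow]
      have := (X_sq_dvd_homogenize_iff hn').1 (hX.trans h)
      rw [Polynomial.natDegree_map] at this
      omega
    · have hdvd := lin_sq_dvd_dehomogenize hn' h
      have hsq : Squarefree (p.map f) :=
        (PerfectField.separable_iff_squarefree.2 hs).map.squarefree
      have hu := hsq _ ((sq _).symm.dvd.trans hdvd)
      have h1 := Polynomial.natDegree_eq_zero_of_isUnit hu
      rw [Polynomial.natDegree_sub_C, Polynomial.natDegree_C_mul_X _ hb] at h1
      exact one_ne_zero h1

theorem card_sqfreeForm [Finite F] (m : ℕ) :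
    Nat.card {c : Fin (m + 2 + 1) → F // SqfreeForm c} =
      {p ∈ degreeWindow F (m + 1) | Squarefree p}.ncard := by
  refine (Nat.card_coe_set_eq {c : Fin (m + 2 + 1) → F | SqfreeForm c}).trans ?_
  refine Set.ncard_congr (fun c _ => dehomogenized c) (fun c hc => (sqfreeForm_iff c).1 hc)
    (fun c d _ _ h => (Polynomial.degreeLTEquiv F _).symm.injective (Subtype.ext h)) ?_
  rintro p ⟨hp, hs⟩
  have hpc : dehomogenized (Polynomial.degreeLTEquiv F (m + 2 + 1) ⟨p, hp.1⟩) = p := by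
    simp [dehomogenized]
  refine ⟨_, ?_, hpc⟩
  rw [Set.mem_ofPred_eq, sqfreeForm_iff, hpc]
  exact ⟨hp, hs⟩

end Dehomogenization

theorem stmt11 (F : Type*) [Field F] [Fintype F] (Q n : ℕ)
    (hQ : Fintype.card F = Q) (hn : 3 ≤ n) :
    (Nat.card {c : Fin (n + 1) → F // SqfreeForm c} : ℝ) =
      (Q : ℝ) ^ (n + 1) *
        (1 - (Q : ℝ) ^ (-1 : ℤ) - (Q : ℝ) ^ (-2 : ℤ) + (Q : ℝ) ^ (-3 : ℤ)) := by
  obtain ⟨k, rfl⟩ := Nat.exists_eq_add_of_le' hn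
  have hQ' : Nat.card F = Q := by rw [Nat.card_eq_fintype_card, hQ]
  have hQ0 : (Q : ℝ) ≠ 0 := by
    rw [← hQ]
    exact_mod_cast Fintype.card_ne_zero
  have h1 := ncard_squarefree_degreeWindow (F := F) k
  have h2 := ncard_degreeWindow_add (F := F) k
  have h3 := ncard_degreeWindow_add (F := F) (k + 2)
  rw [hQ'] at h1 h2 h3
  rw [card_sqfreeForm (k + 1)]
  rify at h1 h2 h3
  have key : ({p ∈ degreeWindow F (k + 2) | Squarefree p}.ncard : ℝ) =
      Q ^ (k + 4) - Q ^ (k + 2) - Q * (Q ^ (k + 2) - Q ^ k) := by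
    linear_combination h1 + h3 - Q * h2
  rw [key]
  simp only [zpow_neg, zpow_ofNat]
  field_simp
  ring
end
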